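/- arXiv:1610.09268 — 3 statements merged into one kernel-verified Lean document; each statement's English description precedes it below -/
import Mathlib

section
/- Let K be an algebraically closed field and let V = V_1 ⊕ … ⊕ V_d be an n-dimensional graded K-vector subspace of R = K[x_1,…,x_N] consisting of forms of degrees between 1 and d, and assume that some homogeneous K-basis of V is a regular sequence in R. Let h be the number of indices i with V_i ≠ 0. Suppose that for every nonzero homogeneous element F of V the ideal of R generated by the partial derivatives ∂F/∂x_1,…,∂F/∂x_N has height at least η + h + 2n − 1. Then R/(V)R satisfies Serre's condition R_η, where (V)R is the ideal of R generated by V; that is, the singular locus of R/(V)R has codimension at least η+1 in R/(V)R. -/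
open MvPolynomial

/-- The height of an ideal: the infimum of the heights of the prime ideals containing it
(so the unit ideal has height `⊤`). -/
noncomputable def idealHeight {R : Type*} [CommRing R] (I : Ideal R) : ℕ∞ :=
  ⨅ (P : PrimeSpectrum R) (_ : I ≤ P.asIdeal), Order.height P

/-- A Noetherian local ring is regular if its maximal ideal is generated by
(Krull dimension)-many elements. -/
def IsRegularLocal (A : Type*) [CommRing A] [IsLocalRing A] : Prop :=
  IsNoetherianRing A ∧
    ∃ s : Finset A, Ideal.span (s : Set A) = IsLocalRing.maximalIdeal A ∧
      (s.card : WithBot ℕ∞) = ringKrullDim A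

/-- Serre's condition `R_η` for a ring `A`: for every prime ideal `P` of `A` of height
at most `η`, the localization of `A` at `P` is a regular local ring. -/
def SerreConditionR (η : ℕ) (A : Type*) [CommRing A] : Prop :=
  ∀ (P : Ideal A) [hP : P.IsPrime],
    Order.height (⟨P, hP⟩ : PrimeSpectrum A) ≤ (η : ℕ∞) →
      IsRegularLocal (Localization.AtPrime P)

/-- `G` is an `R_η`-sequence: it generates a proper ideal and the quotient of the ring by the
ideal generated by each initial segment satisfies Serre's condition `R_η`. -/
def IsRnSequence (η : ℕ) {R : Type*} [CommRing R] {s : ℕ} (G : Fin s → R) : Prop :=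
  Ideal.span (Set.range G) ≠ ⊤ ∧
    ∀ i : ℕ, i ≤ s →
      SerreConditionR η (R ⧸ Ideal.span (G '' {j : Fin s | (j : ℕ) < i}))

/-- `F`, a form of degree `d`, has a `k`-collapse: `F` lies in an ideal generated by
`k` forms of strictly smaller positive degree.  A form of degree `d` has strength at
least `s` iff it has no `s`-collapse. -/
def HasCollapse {K : Type*} [CommSemiring K] {σ : Type*} (d k : ℕ)
    (F : MvPolynomial σ K) : Prop :=
  ∃ (G : Fin k → MvPolynomial σ K) (e : Fin k → ℕ),
    (∀ i, 0 < e i ∧ e i < d ∧ (G i).IsHomogeneous (e i)) ∧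
    F ∈ Ideal.span (Set.range G)

universe u

open Algebra in
theorem Polynomial.exists_nat_le_trdeg_quotient {K A : Type u} [Field K] [CommRing A] [Algebra K A]
    [IsNoetherianRing A] {m : ℕ}
    (hA : ∀ p : Ideal A, p.IsPrime →
      ∃ r : ℕ, (r : Cardinal) ≤ trdeg K (A ⧸ p) ∧ (m : ℕ∞) ≤ p.height + r)
    (P : Ideal (Polynomial A)) (hP : P.IsPrime) :
    ∃ r : ℕ, (r : Cardinal) ≤ trdeg K (Polynomial A ⧸ P) ∧ ((m + 1 : ℕ) : ℕ∞) ≤ P.height + r := by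
  set p : Ideal A := P.comap Polynomial.C with hp
  have hpp : p.IsPrime := Ideal.comap_isPrime _ _
  obtain ⟨r, hr, hm⟩ := hA p hpp
  have hpP : p.map Polynomial.C ≤ P := Ideal.map_comap_le
  have hht : p.height ≤ (p.map Polynomial.C).height := by
    have : (p.map Polynomial.C).LiesOver p := ⟨by
      ext x
      simp [Ideal.under, Ideal.mem_map_C_iff, Polynomial.coeff_C, apply_ite (· ∈ p)]⟩
    rw [Ideal.height_eq_height_add_of_liesOver_of_hasGoingDown p (p.map Polynomial.C)]
    exact le_self_add
  by_cases hcase : p.map Polynomial.C = P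
  · refine ⟨r + 1, ?_, ?_⟩
    · let f : (Polynomial A ⧸ P) →ₐ[K] Polynomial (A ⧸ p) :=
        Ideal.Quotient.liftₐ P (Polynomial.mapAlgHom (Ideal.Quotient.mkₐ K p)) (by
          intro a ha
          rw [← hcase, Ideal.mem_map_C_iff] at ha
          ext n
          simpa using Ideal.Quotient.eq_zero_iff_mem.2 (ha n))
      have hf : Function.Surjective f := by
        refine Function.Surjective.of_comp (g := Ideal.Quotient.mk P) ?_
        exact Polynomial.map_surjective _ Ideal.Quotient.mk_surjective
      refine le_trans ?_ (trdeg_le_of_surjective f hf)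
      rw [← trdeg_add_eq K (A ⧸ p), Polynomial.trdeg_of_isDomain]
      push_cast
      gcongr
    · rw [hcase] at hht
      push_cast
      rw [← add_assoc]
      gcongr
      exact hm.trans (by gcongr)
  · refine ⟨r, ?_, ?_⟩
    · refine hr.trans (trdeg_le_of_injective
        (Ideal.quotientMapₐ (I := p) P (IsScalarTower.toAlgHom K A (Polynomial A)) le_rfl) ?_)
      exact Ideal.quotientMap_injective
    · have := Ideal.height_add_one_le_of_lt_of_isPrime (lt_of_le_of_ne hpP hcase)
      push_cast
      calc (m : ℕ∞) + 1 ≤ p.height + r + 1 := by gcongr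
        _ = p.height + 1 + r := by ring
        _ ≤ P.height + r := by gcongr; exact le_trans (by gcongr) this

open Algebra in
theorem AlgEquiv.exists_nat_le_trdeg_quotient {K A A' : Type u} [Field K] [CommRing A] [Algebra K A]
    [CommRing A'] [Algebra K A'] (e : A ≃ₐ[K] A') {m : ℕ}
    (hA : ∀ p : Ideal A', p.IsPrime →
      ∃ r : ℕ, (r : Cardinal) ≤ trdeg K (A' ⧸ p) ∧ (m : ℕ∞) ≤ p.height + r)
    (P : Ideal A) (hP : P.IsPrime) :
    ∃ r : ℕ, (r : Cardinal) ≤ trdeg K (A ⧸ P) ∧ (m : ℕ∞) ≤ P.height + r := by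
  have hPe : (P.map (e : A ≃+* A')).IsPrime := Ideal.map_isPrime_of_equiv _
  obtain ⟨r, hr, h⟩ := hA _ hPe
  have hh : (P.map (e : A ≃+* A')).height = P.height := RingEquiv.height_map _ _
  rw [hh] at h
  refine ⟨r, hr.trans ?_, h⟩
  exact ((Ideal.quotientEquivAlg P (P.map (e : A ≃+* A')) e rfl).trdeg_eq).ge

open Algebra in
theorem MvPolynomial.exists_nat_le_trdeg_quotient (K : Type u) [Field K] (N : ℕ) :
    ∀ P : Ideal (MvPolynomial (Fin N) K), P.IsPrime →
    ∃ r : ℕ, (r : Cardinal) ≤ trdeg K (MvPolynomial (Fin N) K ⧸ P) ∧ (N : ℕ∞) ≤ P.height + r := by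
  induction N with
  | zero => exact fun P hP => ⟨0, by simp⟩
  | succ N ih =>
    exact (MvPolynomial.finSuccEquiv K N).exists_nat_le_trdeg_quotient
      (Polynomial.exists_nat_le_trdeg_quotient ih)

open Algebra in
theorem Ideal.natCast_le_height_of_isMaximal_of_le_trdeg (K : Type u) {B : Type u} [Field K]
    [CommRing B] [IsDomain B] [Algebra K B] [Algebra.FiniteType K B] (M : Ideal B) [M.IsMaximal]
    {r : ℕ} (hr : (r : Cardinal) ≤ trdeg K B) : (r : ℕ∞) ≤ M.height := by
  obtain ⟨s, g, hg, hfin⟩ := exists_finite_inj_algHom_of_fg K B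
  have hfin' : g.toRingHom.Finite := hfin
  algebraize [g.toRingHom]
  have : IsNoetherianRing B := Algebra.FiniteType.isNoetherianRing K B
  have : FaithfulSMul (MvPolynomial (Fin s) K) B := (faithfulSMul_iff_algebraMap_injective _ _).2 hg
  have : IsScalarTower K (MvPolynomial (Fin s) K) B := IsScalarTower.of_algHom g
  have hs : trdeg K B = s := by
    rw [← trdeg_add_eq K (MvPolynomial (Fin s) K),
      (trdeg_eq_zero : trdeg (MvPolynomial (Fin s) K) B = 0), MvPolynomial.trdeg_of_isDomain]
    simp
  have hrs : r ≤ s := by rw [hs] at hr; exact_mod_cast hr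
  set m := M.under (MvPolynomial (Fin s) K) with hm
  have hmmax : m.IsMaximal := Ideal.isMaximal_comap_of_isIntegral_of_isMaximal M
  have : M.LiesOver m := ⟨rfl⟩
  obtain ⟨t, ht, hst⟩ := MvPolynomial.exists_nat_le_trdeg_quotient K s m hmmax.isPrime
  let _ := Ideal.Quotient.field m
  have : Module.Finite K (MvPolynomial (Fin s) K ⧸ m) :=
    finite_of_finite_type_of_isJacobsonRing K (MvPolynomial (Fin s) K ⧸ m)
  rw [(trdeg_eq_zero : trdeg K (MvPolynomial (Fin s) K ⧸ m) = 0)] at ht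
  have ht0 : t = 0 := by simpa using ht
  rw [Ideal.height_eq_height_add_of_liesOver_of_hasGoingDown m M]
  calc (r : ℕ∞) ≤ s := by exact_mod_cast hrs
    _ ≤ m.height := by simpa [ht0] using hst
    _ ≤ _ := le_self_add
theorem Ideal.exists_isPrime_ker_le_height_add_height_le {R C : Type*} [CommRing R] [CommRing C]
    [IsNoetherianRing C] (f : R →+* C) (hf : Function.Surjective f) (M : Ideal C) [M.IsPrime] :
    ∃ p : Ideal R, p.IsPrime ∧ RingHom.ker f ≤ p ∧
      ((p.height + M.height : ℕ∞) : WithBot ℕ∞) ≤ ringKrullDim R := by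
  obtain ⟨l, hl, hlen⟩ := M.exists_ltSeries_length_eq_height
  have hmono : StrictMono (PrimeSpectrum.comap f) := fun a b hab => by
    rw [← PrimeSpectrum.asIdeal_lt_asIdeal] at hab ⊢
    exact (Ideal.orderEmbeddingOfSurjective f hf).strictMono hab
  let l' := l.map _ hmono
  have : Nonempty (PrimeSpectrum R) := ⟨l'.head⟩
  refine ⟨l'.head.asIdeal, l'.head.2, Ideal.comap_mono bot_le, ?_⟩
  rw [← hlen, PrimeSpectrum.height_eq_orderHeight, ringKrullDim,
    Order.krullDim_eq_iSup_height_add_coheight_of_nonempty, WithBot.coe_le_coe]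
  refine le_trans ?_ (le_iSup _ l'.head)
  gcongr
  exact Order.length_le_coheight_head (p := l')

theorem MvPolynomial.IsHomogeneous.aeval_mul_right {σ K A : Type*} [CommSemiring K]
    [CommSemiring A] [Algebra K A] {F : MvPolynomial σ K} {n : ℕ} (hF : F.IsHomogeneous n)
    (x : σ → A) (z : A) :
    MvPolynomial.aeval (fun i => x i * z) F = z ^ n * MvPolynomial.aeval x F := by
  simp only [aeval_def, eval₂_eq, Finset.mul_sum, mul_pow, Finset.prod_mul_distrib]
  refine Finset.sum_congr rfl fun d hd => ?_
  rw [Finset.prod_pow_eq_pow_sum, ← hF.degree_eq_sum_deg_support hd]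
  ring

theorem MvPolynomial.exists_isPrime_height_add_le {K B : Type u} [Field K] [CommRing B] [IsDomain B]
    [Algebra K B] [Algebra.FiniteType K B] {N n r : ℕ} (hr : (r : Cardinal) ≤ Algebra.trdeg K B)
    (π : B →ₐ[K] K) (s : Fin n → B) (hs : ∀ j, π (s j) = 0) (y : Fin N → B)
    (hy : Function.Surjective
      ((Ideal.Quotient.mkₐ K (Ideal.span (Set.range s))).comp (aeval y))) :
    ∃ p : Ideal (MvPolynomial (Fin N) K), p.IsPrime ∧
      (∀ F, aeval y F ∈ Ideal.span (Set.range s) → F ∈ p) ∧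
      p.height + r ≤ (N : ℕ∞) + n := by
  have : IsNoetherianRing B := Algebra.FiniteType.isNoetherianRing K B
  set J := Ideal.span (Set.range s) with hJ
  have hπ : Function.Surjective π := fun k => ⟨algebraMap K B k, by simp⟩
  have hM : (RingHom.ker π).IsMaximal := RingHom.ker_isMaximal_of_surjective _ hπ
  have hsM : Set.range s ⊆ (RingHom.ker π : Ideal B) := by rintro _ ⟨j, rfl⟩; exact hs j
  have hMht := Ideal.natCast_le_height_of_isMaximal_of_le_trdeg K (RingHom.ker π) hr
  have hle := Ideal.height_le_height_add_encard_of_subset (Set.range s) hsM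
  have : ((RingHom.ker π).map (Ideal.Quotient.mk J)).IsPrime :=
    Ideal.isPrime_map_quotientMk_of_isPrime (Ideal.span_le.2 hsM)
  obtain ⟨p, hp, hker, hdim⟩ := Ideal.exists_isPrime_ker_le_height_add_height_le
    ((Ideal.Quotient.mkₐ K J).comp (aeval y)).toRingHom hy
    ((RingHom.ker π).map (Ideal.Quotient.mk J))
  refine ⟨p, hp, fun F hF => hker ?_, ?_⟩
  · exact Ideal.Quotient.eq_zero_iff_mem.2 hF
  · have hcard : (Set.range s).encard ≤ n := by
      simpa [Set.image_univ, Set.encard_univ] using Set.encard_image_le s Set.univ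
    have hN : ringKrullDim (MvPolynomial (Fin N) K) = ((N : ℕ∞) : WithBot ℕ∞) := by
      rw [MvPolynomial.ringKrullDim_of_isNoetherianRing, ringKrullDim_eq_zero_of_field]
      simp
    rw [hN, WithBot.coe_le_coe] at hdim
    calc p.height + r ≤ p.height +
          (((RingHom.ker π).map (Ideal.Quotient.mk J)).height + (Set.range s).encard) := by
            gcongr
            exact hMht.trans hle
      _ ≤ N + n := by
        rw [← add_assoc]
        gcongr

open Algebra in
theorem Algebra.natCast_add_one_le_trdeg_of_isAlgebraic {K L : Type u} [Field K] [Field L]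
    [Algebra K L] {N r : ℕ} (x : Fin N → L)
    (hx : ∀ l : L, ∃ u v : MvPolynomial (Fin N) K, aeval x u ≠ 0 ∧ l * aeval x u = aeval x v)
    (hr : (r : Cardinal) ≤ Algebra.trdeg K L) (B : Subalgebra K (Polynomial L))
    (hX : Polynomial.X ∈ B) (hxB : ∀ i, Polynomial.C (x i) * Polynomial.X ∈ B) :
    ((r + 1 : ℕ) : Cardinal) ≤ Algebra.trdeg K B := by
  have hXalg : IsAlgebraic B (Polynomial.X : Polynomial L) :=
    isAlgebraic_algebraMap (⟨_, hX⟩ : B)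
  have hxalg (i : Fin N) : IsAlgebraic B (Polynomial.C (x i)) := by
    refine IsAlgebraic.of_mul (mem_nonZeroDivisors_of_ne_zero Polynomial.X_ne_zero) hXalg ?_
    rw [mul_comm]
    exact isAlgebraic_algebraMap (⟨_, hxB i⟩ : B)
  have hpoly (F : MvPolynomial (Fin N) K) : IsAlgebraic B (Polynomial.C (aeval x F)) := by
    induction F using MvPolynomial.induction_on with
    | C a =>
      rw [aeval_C]
      exact isAlgebraic_algebraMap (algebraMap K B a)
    | add p q hp hq => rw [map_add, map_add]; exact hp.add hq
    | mul_X p i hp => rw [map_mul, map_mul, aeval_X]; exact hp.mul (hxalg i)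
  have hC (l : L) : IsAlgebraic B (Polynomial.C l) := by
    obtain ⟨u, v, hu, huv⟩ := hx l
    refine IsAlgebraic.of_mul (y := Polynomial.C (aeval x u))
      (mem_nonZeroDivisors_of_ne_zero (Polynomial.C_ne_zero.2 hu)) (hpoly u) ?_
    rw [← map_mul, mul_comm, huv]
    exact hpoly v
  have : Algebra.IsAlgebraic B (Polynomial L) := ⟨fun F => by
    induction F using Polynomial.induction_on' with
    | add p q hp hq => exact hp.add hq
    | monomial n a =>
      rw [← Polynomial.C_mul_X_pow_eq_monomial]
      exact (hC a).mul (hXalg.pow n)⟩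
  have h1 := trdeg_add_eq K B (A := Polynomial L)
  rw [(trdeg_eq_zero : Algebra.trdeg B (Polynomial L) = 0), add_zero,
    ← trdeg_add_eq K L (A := Polynomial L), Polynomial.trdeg_of_isDomain] at h1
  rw [h1]
  push_cast
  gcongr

theorem IsAlgClosed.exists_algHom_ker_le {K B : Type*} [Field K] [IsAlgClosed K] [CommRing B]
    [Algebra K B] [Algebra.FiniteType K B] (I : Ideal B) (hI : I ≠ ⊤) :
    ∃ π : B →ₐ[K] K, ∀ b ∈ I, π b = 0 := by
  obtain ⟨M, hM, hIM⟩ := Ideal.exists_le_maximal I hI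
  let _ := Ideal.Quotient.field M
  have : Module.Finite K (B ⧸ M) := finite_of_finite_type_of_isJacobsonRing K (B ⧸ M)
  let e : K ≃ₐ[K] (B ⧸ M) := AlgEquiv.ofBijective (Algebra.ofId K (B ⧸ M))
    IsAlgClosed.algebraMap_bijective_of_isIntegral
  refine ⟨(e.symm : (B ⧸ M) →ₐ[K] K).comp (Ideal.Quotient.mkₐ K M), fun b hb => ?_⟩
  have : Ideal.Quotient.mkₐ K M b = 0 := Ideal.Quotient.eq_zero_iff_mem.2 (hIM hb)
  rw [AlgHom.comp_apply, this, map_zero]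

theorem MvPolynomial.exists_isPrime_sum_mem_height_add_le {K L : Type u} [Field K] [IsAlgClosed K]
    [Field L] [Algebra K L] {N n r : ℕ} (x : Fin N → L)
    (hx : ∀ l : L, ∃ u v : MvPolynomial (Fin N) K, aeval x u ≠ 0 ∧ l * aeval x u = aeval x v)
    (hr : (r : Cardinal) ≤ Algebra.trdeg K L) (c : Fin n → L) (e : Fin n → ℕ) (j₀ : Fin n)
    (hc₀ : c j₀ = 1) (hc : ∀ j, c j ≠ 0 → e j ≤ e j₀) :
    ∃ (b : Fin n → K) (p : Ideal (MvPolynomial (Fin N) K)), b j₀ = 1 ∧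
      (∀ j, b j ≠ 0 → e j = e j₀) ∧ p.IsPrime ∧ p.height + (r + 1 : ℕ) ≤ (N : ℕ∞) + n ∧
      ∀ H : Fin n → MvPolynomial (Fin N) K, (∀ j, (H j).IsHomogeneous (e j)) →
        ∑ j, c j * aeval x (H j) = 0 → ∑ j, C (b j) * H j ∈ p := by
  classical
  let gens : Set (Polynomial L) := Set.range (fun i => Polynomial.C (x i) * Polynomial.X) ∪
    ({Polynomial.X} ∪ Set.range fun j => Polynomial.C (c j) * Polynomial.X ^ (e j₀ - e j))
  have hgens : gens.Finite :=
    (Set.finite_range _).union ((Set.finite_singleton _).union (Set.finite_range _))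
  let B := Algebra.adjoin K gens
  have hB : gens ⊆ B := Algebra.subset_adjoin
  let y (i : Fin N) : B := ⟨_, hB (Or.inl ⟨i, rfl⟩)⟩
  let z : B := ⟨_, hB (Or.inr (Or.inl rfl))⟩
  let t (j : Fin n) : B := ⟨_, hB (Or.inr (Or.inr ⟨j, rfl⟩))⟩
  have : Algebra.FiniteType K B :=
    (Subalgebra.fg_iff_finiteType _).1 (Subalgebra.fg_def.2 ⟨gens, hgens, rfl⟩)
  have hrB := Algebra.natCast_add_one_le_trdeg_of_isAlgebraic x hx hr B z.2 fun i => (y i).2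
  let φ : B →+* L := (Polynomial.evalRingHom 0).comp B.val.toRingHom
  obtain ⟨π, hπ⟩ := IsAlgClosed.exists_algHom_ker_le (K := K) (RingHom.ker φ)
    (RingHom.ker_ne_top φ)
  have hz : π z = 0 := hπ z (by simp [φ, z, RingHom.mem_ker])
  have ht₀ : t j₀ = 1 := Subtype.ext (by simp [t, hc₀])
  have ht (j) (hj : e j ≠ e j₀) : π (t j) = 0 := by
    refine hπ _ ?_
    by_cases hcj : c j = 0
    · simp [φ, t, RingHom.mem_ker, hcj]
    · have := hc j hcj
      have : e j₀ - e j ≠ 0 := by omega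
      simp [φ, t, RingHom.mem_ker, this]
  let s (j : Fin n) : B := if j = j₀ then z else t j - algebraMap K B (π (t j))
  have hs (j) : π (s j) = 0 := by
    by_cases hj : j = j₀ <;> simp [s, hj, hz]
  set J := Ideal.span (Set.range s) with hJ
  have hzJ : z ∈ J := Ideal.subset_span ⟨j₀, by simp [s]⟩
  have htJ (j) : t j - algebraMap K B (π (t j)) ∈ J := by
    by_cases hj : j = j₀
    · simp [hj, ht₀]
    · exact Ideal.subset_span ⟨j, by simp [s, hj]⟩
  have hy : Function.Surjective ((Ideal.Quotient.mkₐ K J).comp (aeval y)) := by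
    let A := ((Ideal.Quotient.mkₐ K J).comp (aeval (R := K) y)).range
    suffices A.comap (Ideal.Quotient.mkₐ K J) = ⊤ by
      intro q
      obtain ⟨q, rfl⟩ := Ideal.Quotient.mk_surjective q
      exact (this ▸ Algebra.mem_top : q ∈ A.comap (Ideal.Quotient.mkₐ K J))
    rw [← top_le_iff, ← Algebra.adjoin_adjoin_coe_preimage, Algebra.adjoin_le_iff]
    rintro ⟨q, hq⟩ (⟨i, rfl⟩ | rfl | ⟨j, rfl⟩)
    · exact ⟨X i, by simp [y]⟩
    · exact ⟨0, by simpa using (Ideal.Quotient.eq_zero_iff_mem.2 hzJ).symm⟩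
    · refine ⟨C (π (t j)), ?_⟩
      simpa using (Ideal.Quotient.mk_eq_mk_iff_sub_mem _ _).2 (htJ j) |>.symm
  obtain ⟨p, hp, hpJ, hpN⟩ := MvPolynomial.exists_isPrime_height_add_le hrB π s hs y hy
  refine ⟨fun j => π (t j), p, by simp [ht₀], fun j => not_imp_comm.1 (ht j), hp, hpN, ?_⟩
  intro H hH hsum
  apply hpJ
  have hval (j) : B.val (aeval y (H j)) =
      Polynomial.X ^ e j * Polynomial.C (aeval x (H j)) := by
    rw [← AlgHom.comp_apply, MvPolynomial.comp_aeval]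
    refine ((hH j).aeval_mul_right (fun i => Polynomial.C (x i)) Polynomial.X).trans ?_
    congr 1
    exact (comp_aeval_apply x (IsScalarTower.toAlgHom K L (Polynomial L)) (H j)).symm
  have hzero : ∑ j, t j * aeval y (H j) = 0 := by
    have hterm (j) : B.val (t j * aeval y (H j)) =
        Polynomial.X ^ e j₀ * Polynomial.C (c j * aeval x (H j)) := by
      rw [map_mul, hval]
      by_cases hcj : c j = 0
      · simp [t, hcj]
      · simp only [t, Subalgebra.coe_val, map_mul]
        rw [← Nat.sub_add_cancel (hc j hcj), pow_add, Nat.add_sub_cancel]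
        ring
    apply Subtype.val_injective
    change B.val _ = B.val 0
    rw [map_sum, Finset.sum_congr rfl fun j _ => hterm j, ← Finset.mul_sum, ← map_sum, hsum]
    simp
  have : aeval y (∑ j, C (π (t j)) * H j) =
      -∑ j, (t j - algebraMap K B (π (t j))) * aeval y (H j) := by
    simp [sub_mul, Finset.sum_sub_distrib, hzero]
  rw [this]
  exact neg_mem (sum_mem fun j _ => Ideal.mul_mem_right _ _ (htJ j))

open Algebra in
theorem MvPolynomial.exists_isPrime_pderiv_mem_height_add_one_le {K : Type u} [Field K]
    [IsAlgClosed K] {N n : ℕ} (P : Ideal (MvPolynomial (Fin N) K)) [P.IsPrime]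
    (G : Fin n → MvPolynomial (Fin N) K) (e : Fin n → ℕ) (hG : ∀ j, (G j).IsHomogeneous (e j + 1))
    (a : Fin n → MvPolynomial (Fin N) K) (ha : ∃ j, a j ∉ P)
    (haG : ∀ i, ∑ j, a j * pderiv i (G j) ∈ P) :
    ∃ (b : Fin n → K) (j₀ : Fin n) (p : Ideal (MvPolynomial (Fin N) K)), b j₀ = 1 ∧
      (∀ j, b j ≠ 0 → e j = e j₀) ∧ p.IsPrime ∧ p.height + 1 ≤ P.height + n ∧
      ∀ i, pderiv i (∑ j, b j • G j) ∈ p := by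
  classical
  obtain ⟨j₁, hj₁⟩ := ha
  obtain ⟨j₀, hj₀, hmax⟩ := Finset.exists_max_image {j | a j ∉ P} e ⟨j₁, by simpa using hj₁⟩
  simp only [Finset.mem_filter_univ] at hj₀ hmax
  let L := FractionRing (MvPolynomial (Fin N) K ⧸ P)
  let ψ : MvPolynomial (Fin N) K →ₐ[K] L :=
    (IsScalarTower.toAlgHom K (MvPolynomial (Fin N) K ⧸ P) L).comp (Ideal.Quotient.mkₐ K P)
  have hψ (F) : ψ F = 0 ↔ F ∈ P := by
    rw [← Ideal.Quotient.eq_zero_iff_mem]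
    exact (FaithfulSMul.algebraMap_injective (MvPolynomial (Fin N) K ⧸ P) L).eq_iff' (map_zero _)
  let x (i : Fin N) : L := ψ (X i)
  have hx : aeval x = ψ := algHom_ext fun i => by simp [x]
  have hfrac (l : L) : ∃ u v : MvPolynomial (Fin N) K,
      aeval x u ≠ 0 ∧ l * aeval x u = aeval x v := by
    obtain ⟨⟨v, u⟩, huv⟩ := IsLocalization.surj (nonZeroDivisors (MvPolynomial (Fin N) K ⧸ P)) l
    obtain ⟨u', hu'⟩ := Ideal.Quotient.mk_surjective u.1
    obtain ⟨v', hv'⟩ := Ideal.Quotient.mk_surjective v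
    refine ⟨u', v', ?_, ?_⟩
    · rw [hx, Ne, hψ, ← Ideal.Quotient.eq_zero_iff_mem, hu']
      exact nonZeroDivisors.coe_ne_zero u
    · rw [hx]
      change l * algebraMap _ L (Ideal.Quotient.mk P u') = algebraMap _ L (Ideal.Quotient.mk P v')
      rw [hu', hv']
      exact huv
  obtain ⟨r, hr, hrN⟩ := MvPolynomial.exists_nat_le_trdeg_quotient K N P inferInstance
  have hrL : (r : Cardinal) ≤ Algebra.trdeg K L :=
    hr.trans (trdeg_le_of_injective
      (IsScalarTower.toAlgHom K (MvPolynomial (Fin N) K ⧸ P) L)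
      (FaithfulSMul.algebraMap_injective _ _))
  have hne : ψ (a j₀) ≠ 0 := (hψ _).not.2 hj₀
  obtain ⟨b, p, hb₀, hb, hp, hpN, hH⟩ := MvPolynomial.exists_isPrime_sum_mem_height_add_le x hfrac
    hrL (fun j => ψ (a j) / ψ (a j₀)) e j₀ (div_self hne) fun j hj =>
      hmax j ((hψ _).not.1 fun h => hj (by simp [h]))
  refine ⟨b, j₀, p, hb₀, hb, hp, ?_, fun i => ?_⟩
  · have : p.height + 1 + r ≤ P.height + n + r := by
      calc p.height + 1 + r = p.height + (r + 1 : ℕ) := by push_cast; ring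
        _ ≤ N + n := hpN
        _ ≤ P.height + r + n := by gcongr
        _ = P.height + n + r := by ring
    exact (WithTop.add_le_add_iff_right (ENat.natCast_ne_top r)).1 this
  · have := hH (fun j => pderiv i (G j)) (fun j => by simpa using (hG j).pderiv) (by
      have h0 := (hψ _).2 (haG i)
      rw [map_sum] at h0
      simp_rw [hx, div_mul_eq_mul_div, ← Finset.sum_div, ← map_mul, h0, zero_div])
    simpa [smul_eq_C_mul, pderiv_C_mul] using this

open IsLocalRing in
theorem IsLocalRing.spanFinrank_maximalIdeal_add_le_of_linearIndependent {A A' : Type*}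
    [CommRing A] [CommRing A'] [IsLocalRing A] [IsLocalRing A'] [IsNoetherianRing A] (f : A →+* A')
    (hf : (maximalIdeal A).map f = maximalIdeal A') {n : ℕ} (g : Fin n → maximalIdeal A)
    (hg : LinearIndependent (ResidueField A)
      fun j => ((maximalIdeal A).toCotangent (g j) : CotangentSpace A))
    (hfg : ∀ j, f (g j) = 0) :
    (maximalIdeal A').spanFinrank + n ≤ (maximalIdeal A).spanFinrank := by
  set W := Submodule.span (ResidueField A)
    (Set.range fun j => ((maximalIdeal A).toCotangent (g j) : CotangentSpace A)) with hW
  obtain ⟨W', hWW'⟩ := Submodule.exists_isCompl W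
  have hrank : n + Module.finrank (ResidueField A) W' = (maximalIdeal A).spanFinrank := by
    rw [spanFinrank_maximalIdeal_eq_finrank_cotangentSpace,
      ← Submodule.finrank_add_eq_of_isCompl hWW', hW, finrank_span_eq_card hg, Fintype.card_fin]
  let w := Module.finBasis (ResidueField A) W'
  choose u hu using fun k => (maximalIdeal A).toCotangent_surjective (w k : CotangentSpace A)
  have hspan : Submodule.span A (Set.range g ∪ Set.range u) = ⊤ := by
    rw [← CotangentSpace.span_image_eq_top_iff, Set.image_union, Submodule.span_union,
      ← Set.range_comp, ← Set.range_comp, ← hWW'.sup_eq_top]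
    congr 1
    have : (maximalIdeal A).toCotangent ∘ u = W'.subtype ∘ w := funext hu
    rw [this, Set.range_comp, Submodule.span_image, w.span_eq, Submodule.map_top,
      Submodule.range_subtype]
  have hm : maximalIdeal A = Ideal.span ((Set.range g ∪ Set.range u).image Subtype.val) := by
    have := congrArg (Submodule.map (maximalIdeal A).subtype) hspan
    rw [Submodule.map_span, Submodule.map_top, Submodule.range_subtype] at this
    exact this.symm
  have hm' : maximalIdeal A' = Ideal.span (Set.range fun k => f (u k)) := by
    rw [← hf]
    conv_lhs => rw [hm]
    rw [Ideal.map_span]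
    apply le_antisymm <;> rw [Ideal.span_le]
    · rintro _ ⟨_, ⟨_, ⟨j, rfl⟩ | ⟨k, rfl⟩, rfl⟩, rfl⟩
      · simp [hfg]
      · exact Ideal.subset_span ⟨k, rfl⟩
    · rintro _ ⟨k, rfl⟩
      exact Ideal.subset_span ⟨_, ⟨_, Or.inr ⟨k, rfl⟩, rfl⟩, rfl⟩
  have hle : (maximalIdeal A').spanFinrank ≤ Module.finrank (ResidueField A) W' := by
    rw [hm']
    refine (Submodule.spanFinrank_span_le_ncard_of_finite (Set.finite_range _)).trans ?_
    rw [← Set.image_univ]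
    exact (Set.ncard_image_le Set.finite_univ).trans (by simp)
  omega

theorem Derivation.apply_mem_of_mem_sq {R A : Type*} [CommRing R] [CommRing A] [Algebra R A]
    (D : Derivation R A A) {P : Ideal A} {a : A} (ha : a ∈ P ^ 2) : D a ∈ P := by
  rw [pow_two] at ha
  refine Submodule.mul_induction_on ha (fun x hx y hy => ?_) fun x y hx hy => ?_
  · rw [D.leibniz]
    exact add_mem (Ideal.mul_mem_right _ _ hx) (Ideal.mul_mem_right _ _ hy)
  · rw [map_add]
    exact add_mem hx hy

open IsLocalRing in
theorem Localization.AtPrime.linearIndependent_toCotangent_of_derivation {R A : Type*} [CommRing R]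
    [CommRing A] [Algebra R A] {ι : Type*} (D : ι → Derivation R A A) (P : Ideal A) [P.IsPrime]
    {n : ℕ} (G : Fin n → A) (hG : ∀ j, G j ∈ P)
    (hD : ∀ a : Fin n → A, (∀ i, ∑ j, a j * D i (G j) ∈ P) → ∀ j, a j ∈ P)
    (g : Fin n → maximalIdeal (Localization.AtPrime P))
    (hg : ∀ j, (g j : Localization.AtPrime P) = algebraMap A _ (G j)) :
    LinearIndependent (ResidueField (Localization.AtPrime P))
      fun j => ((maximalIdeal _).toCotangent (g j) : CotangentSpace (Localization.AtPrime P)) := by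
  rw [Fintype.linearIndependent_iff]
  intro c hc
  choose l hl using fun j => residue_surjective (c j)
  obtain ⟨s, hs⟩ := IsLocalization.exist_integer_multiples_of_finite P.primeCompl l
  choose a ha using hs
  have hsum : ∑ j, l j * algebraMap A (Localization.AtPrime P) (G j) ∈
      maximalIdeal (Localization.AtPrime P) ^ 2 := by
    have h0 : (maximalIdeal (Localization.AtPrime P)).toCotangent (∑ j, l j • g j) = 0 := by
      rw [map_sum, ← hc]
      refine Finset.sum_congr rfl fun j _ => ?_
      rw [← hl j, map_smul]
      rfl
    rw [Ideal.toCotangent_eq_zero] at h0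
    simpa [hg] using h0
  have hasum : algebraMap A (Localization.AtPrime P) (∑ j, a j * G j) ∈
      (P ^ 2).map (algebraMap A (Localization.AtPrime P)) := by
    rw [Ideal.map_pow, Localization.AtPrime.map_eq_maximalIdeal]
    convert Ideal.mul_mem_left _ (algebraMap A (Localization.AtPrime P) s) hsum using 1
    rw [map_sum, Finset.mul_sum]
    refine Finset.sum_congr rfl fun j _ => ?_
    rw [map_mul, ha, Algebra.smul_def, mul_assoc]
  obtain ⟨v, hv, hmem⟩ :=
    (IsLocalization.algebraMap_mem_map_algebraMap_iff P.primeCompl _ _ _).1 hasum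
  have haP := hD a fun i => by
    have h := (D i).apply_mem_of_mem_sq hmem
    rw [Derivation.leibniz, map_sum] at h
    have h1 : (∑ j, a j * G j) • D i v ∈ P :=
      Ideal.mul_mem_right _ _ (sum_mem fun j _ => Ideal.mul_mem_left _ _ (hG j))
    have h2 := (Submodule.add_mem_iff_left _ h1).1 h
    have h3 := (Ideal.IsPrime.mem_or_mem ‹P.IsPrime› h2).resolve_left hv
    have h4 : ∑ j, D i (a j * G j) = ∑ j, a j * D i (G j) + ∑ j, G j * D i (a j) := by
      simp [Derivation.leibniz, Finset.sum_add_distrib]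
    rw [h4] at h3
    exact (Submodule.add_mem_iff_left _ (sum_mem fun j _ => Ideal.mul_mem_right _ _ (hG j))).1 h3
  intro j
  rw [← hl j, residue_eq_zero_iff]
  have h1 : algebraMap A (Localization.AtPrime P) (a j) ∈ maximalIdeal _ := by
    rw [← Localization.AtPrime.map_eq_maximalIdeal]
    exact Ideal.mem_map_of_mem _ (haP j)
  rw [ha, Algebra.smul_def] at h1
  refine (Ideal.IsPrime.mem_or_mem inferInstance h1).resolve_left fun h => ?_
  exact (mem_maximalIdeal _).1 h (IsLocalization.map_units _ s)

open IsLocalRing in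
theorem Localization.AtPrime.isRegularLocalRing_quotient {A : Type*} [CommRing A] [IsRegularRing A]
    {n : ℕ} (G : Fin n → A) (Q : Ideal (A ⧸ Ideal.span (Set.range G))) [Q.IsPrime]
    (P : Ideal A) [P.IsPrime] (hPQ : P = Q.comap (Ideal.Quotient.mk _))
    (hP : P.height ≤ Q.height + n)
    (hG : ∀ g : Fin n → maximalIdeal (Localization.AtPrime P),
      (∀ j, (g j : Localization.AtPrime P) = algebraMap A _ (G j)) →
      LinearIndependent (ResidueField (Localization.AtPrime P))
        fun j => ((maximalIdeal _).toCotangent (g j) : CotangentSpace (Localization.AtPrime P))) :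
    IsRegularLocalRing (Localization.AtPrime Q) := by
  let f := Localization.localRingHom P Q (Ideal.Quotient.mk (Ideal.span (Set.range G))) hPQ
  have hf (x : A) : f (algebraMap A _ x) = algebraMap _ _ (Ideal.Quotient.mk _ x) :=
    Localization.localRingHom_to_map P Q _ hPQ x
  have hGI (j) : Ideal.Quotient.mk (Ideal.span (Set.range G)) (G j) = 0 :=
    Ideal.Quotient.eq_zero_iff_mem.2 (Ideal.subset_span ⟨j, rfl⟩)
  have hGP (j) : G j ∈ P := by simp [hPQ, Ideal.mem_comap, hGI]
  have hm : (maximalIdeal (Localization.AtPrime P)).map f =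
      maximalIdeal (Localization.AtPrime Q) := by
    rw [← Localization.AtPrime.map_eq_maximalIdeal, Ideal.map_map,
      show f.comp (algebraMap A _) = (algebraMap _ _).comp (Ideal.Quotient.mk _) from
        RingHom.ext hf, ← Ideal.map_map, hPQ,
      Ideal.map_comap_of_surjective _ Ideal.Quotient.mk_surjective,
      Localization.AtPrime.map_eq_maximalIdeal]
  let g (j : Fin n) : maximalIdeal (Localization.AtPrime P) :=
    ⟨algebraMap A _ (G j), by
      rw [← Localization.AtPrime.map_eq_maximalIdeal]
      exact Ideal.mem_map_of_mem _ (hGP j)⟩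
  have hle := spanFinrank_maximalIdeal_add_le_of_linearIndependent f hm g (hG g fun _ => rfl)
    fun j => by simp [g, hf, hGI]
  have hreg := (isRegularLocalRing_iff _).1
    (inferInstance : IsRegularLocalRing (Localization.AtPrime P))
  rw [IsLocalization.AtPrime.ringKrullDim_eq_height P (Localization.AtPrime P)] at hreg
  refine IsRegularLocalRing.of_spanFinrank_maximalIdeal_le _ ?_
  rw [IsLocalization.AtPrime.ringKrullDim_eq_height Q (Localization.AtPrime Q)]
  have hreg' : ((maximalIdeal (Localization.AtPrime P)).spanFinrank : ℕ∞) = P.height := by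
    exact_mod_cast hreg
  have : ((maximalIdeal (Localization.AtPrime Q)).spanFinrank : ℕ∞) + n ≤ Q.height + n := by
    rw [← hreg'] at hP
    exact le_trans (by exact_mod_cast hle) hP
  exact_mod_cast (WithTop.add_le_add_iff_right (ENat.natCast_ne_top n)).1 this

theorem IsRegularLocalRing.isRegularLocal {A : Type*} [CommRing A] [IsLocalRing A]
    (h : IsRegularLocalRing A) : IsRegularLocal A := by
  have hfg : Submodule.FG (IsLocalRing.maximalIdeal A) := IsNoetherian.noetherian _
  refine ⟨inferInstance, hfg.finite_generators.toFinset, ?_, ?_⟩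
  · rw [Set.Finite.coe_toFinset]
    exact (IsLocalRing.maximalIdeal A).span_generators
  · rw [← (isRegularLocalRing_iff A).1 h, ← hfg.generators_ncard,
      Set.ncard_eq_toFinset_card _ hfg.finite_generators]

theorem idealHeight_le_height {R : Type*} [CommRing R] {I p : Ideal R} [hp : p.IsPrime]
    (h : I ≤ p) : idealHeight I ≤ p.height := by
  rw [PrimeSpectrum.height_eq_orderHeight ⟨p, hp⟩]
  exact iInf₂_le (⟨p, hp⟩ : PrimeSpectrum R) h

/-- Let `V = V_1 ⊕ ⋯ ⊕ V_d` be an `n`-dimensional graded subspace of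
`R = K[x_1, …, x_N]` (`K` algebraically closed) consisting of forms of degrees between `1` and
`d`, some homogeneous basis of which is a regular sequence in `R`.  Let `h` be the number of
indices `i` with `V_i ≠ 0`.  If for every nonzero homogeneous `F ∈ V` the ideal generated by
the partial derivatives of `F` has height at least `η + h + 2n − 1`, then `R/(V)R` satisfies
Serre's condition `R_η`. -/
theorem statement17 (K : Type u) [Field K] [IsAlgClosed K] (N d n η : ℕ)
    (V : Fin d → Submodule K (MvPolynomial (Fin N) K))
    (hhom : ∀ i, V i ≤ homogeneousSubmodule (Fin N) K ((i : ℕ) + 1))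
    (hfin : ∀ i, FiniteDimensional K (V i))
    (hn : (∑ i, Module.finrank K (V i)) = n)
    (hbasis : ∃ G : Fin n → MvPolynomial (Fin N) K,
      (∀ j, ∃ i, G j ∈ V i) ∧ LinearIndependent K G ∧
      Submodule.span K (Set.range G) = (⨆ i, V i) ∧
      RingTheory.Sequence.IsRegular (MvPolynomial (Fin N) K) (List.ofFn G))
    (h : ℕ) (hh : h = Nat.card {i : Fin d // V i ≠ ⊥})
    (hder : ∀ i : Fin d, ∀ F ∈ V i, F ≠ 0 →
      ((η + h + 2 * n - 1 : ℕ) : ℕ∞) ≤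
        idealHeight (Ideal.span (Set.range fun j : Fin N => pderiv j F))) :
    SerreConditionR η
      (MvPolynomial (Fin N) K ⧸
        Ideal.span ((⨆ i, V i : Submodule K (MvPolynomial (Fin N) K)) :
          Set (MvPolynomial (Fin N) K))) := by
  obtain ⟨G, hGV, hGli, hGspan, -⟩ := hbasis
  choose e he using hGV
  have hspan : Ideal.span ((⨆ i, V i : Submodule K (MvPolynomial (Fin N) K)) :
      Set (MvPolynomial (Fin N) K)) = Ideal.span (Set.range G) := by
    rw [← hGspan, Ideal.span, Submodule.span_span_of_tower]
  rw [hspan]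
  intro Q hQ hQη
  have hQη' : Q.height ≤ η := by
    rwa [PrimeSpectrum.height_eq_orderHeight ⟨Q, hQ⟩]
  refine IsRegularLocalRing.isRegularLocal ?_
  have hle : Ideal.span (Set.range G) ≤
      Q.comap (Ideal.Quotient.mk (Ideal.span (Set.range G))) := by
    intro x hx
    rw [Ideal.mem_comap, Ideal.Quotient.eq_zero_iff_mem.2 hx]
    exact zero_mem _
  have hP : (Q.comap (Ideal.Quotient.mk (Ideal.span (Set.range G)))).height ≤ Q.height + n := by
    refine (Ideal.height_le_height_add_encard_of_subset _ (Ideal.span_le.1 hle)).trans ?_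
    rw [Ideal.map_comap_of_surjective _ Ideal.Quotient.mk_surjective]
    gcongr
    simpa [Set.image_univ, Set.encard_univ] using Set.encard_image_le G Set.univ
  refine Localization.AtPrime.isRegularLocalRing_quotient G Q _ rfl hP fun g hg => ?_
  refine Localization.AtPrime.linearIndependent_toCotangent_of_derivation (R := K)
    (fun i : Fin N => pderiv i) _ G (fun j => hle (Ideal.subset_span ⟨j, rfl⟩)) ?_ g hg
  by_contra! hcon
  obtain ⟨a, haG, ha⟩ := hcon
  obtain ⟨b, j₀, p, hb₀, hb, hp, hpht, hpder⟩ :=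
    MvPolynomial.exists_isPrime_pderiv_mem_height_add_one_le _ G (fun j => (e j : ℕ))
      (fun j => hhom _ (he j)) a ha haG
  have hFV : ∑ j, b j • G j ∈ V (e j₀) := sum_mem fun j _ => by
    by_cases hbj : b j = 0
    · simp [hbj]
    · exact Submodule.smul_mem _ _ (Fin.ext (hb j hbj) ▸ he j)
  have hF0 : ∑ j, b j • G j ≠ 0 := fun h0 => by
    have := Fintype.linearIndependent_iff.1 hGli b h0 j₀
    simp [hb₀] at this
  have hVne : V (e j₀) ≠ ⊥ := fun hbot => hF0 (by simpa [hbot] using hFV)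
  have hh1 : 1 ≤ h := by
    have : Nonempty {i : Fin d // V i ≠ ⊥} := ⟨⟨_, hVne⟩⟩
    rw [hh]
    exact Nat.card_pos
  have hn1 : 1 ≤ n := j₀.pos
  have hlow : ((η + h + 2 * n - 1 : ℕ) : ℕ∞) ≤ p.height :=
    (hder _ _ hFV hF0).trans (idealHeight_le_height (Ideal.span_le.2 (by
      rintro _ ⟨i, rfl⟩
      exact hpder i)))
  have hup : ((η + h + 2 * n - 1 + 1 : ℕ) : ℕ∞) ≤ ((η + n + n : ℕ) : ℕ∞) := by
    push_cast
    calc ((η + h + 2 * n - 1 : ℕ) : ℕ∞) + 1 ≤ p.height + 1 := by gcongr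
      _ ≤ _ := hpht
      _ ≤ η + n + n := by gcongr; exact hP.trans (by gcongr)
  have := ENat.natCast_le_natCast.1 hup
  omega
end

section
/- Let R be a commutative Noetherian Jacobson ring (every prime ideal of R is an intersection of maximal ideals), and let S be an R-algebra that is intersection flat over R: S is flat over R and for every family {I_λ} of ideals of R one has ⋂_λ (I_λ S) = (⋂_λ I_λ) S. If S/mS is an integral domain for every maximal ideal m of R, then S/PS is an integral domain for every prime ideal P of R. -/
universe u v

/-- Let `R` be a commutative Noetherian Jacobson ring and `S` an `R`-algebra
that is flat and intersection flat over `R` (extension of ideals commutes with arbitrary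
intersections of families of ideals of `R`).  If `S/mS` is a domain for every maximal ideal `m`
of `R`, then `S/PS` is a domain for every prime ideal `P` of `R`. -/
theorem statement18 (R : Type u) (S : Type v) [CommRing R] [IsNoetherianRing R]
    [IsJacobsonRing R] [CommRing S] [Algebra R S] [Module.Flat R S]
    (hint : ∀ 𝒜 : Set (Ideal R),
      (⨅ I ∈ 𝒜, Ideal.map (algebraMap R S) I) = Ideal.map (algebraMap R S) (⨅ I ∈ 𝒜, I))
    (hmax : ∀ m : Ideal R, m.IsMaximal → IsDomain (S ⧸ Ideal.map (algebraMap R S) m)) :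
    ∀ P : Ideal R, P.IsPrime → IsDomain (S ⧸ Ideal.map (algebraMap R S) P) := by
  intro P hP
  have hprime : ∀ m : Ideal R, m.IsMaximal → (Ideal.map (algebraMap R S) m).IsPrime :=
    fun m hm => (Ideal.Quotient.isDomain_iff_prime _).1 (hmax m hm)
  have mem_map : ∀ (𝒜 : Set (Ideal R)) (x : S), sInf 𝒜 ≤ P →
      (∀ m ∈ 𝒜, x ∈ Ideal.map (algebraMap R S) m) → x ∈ Ideal.map (algebraMap R S) P := by
    intro 𝒜 x hle hx
    refine Ideal.map_mono hle ?_
    rw [sInf_eq_iInf, ← hint 𝒜]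
    simpa only [Ideal.mem_iInf] using hx
  rw [Ideal.Quotient.isDomain_iff_prime]
  refine ⟨fun htop => ?_, fun {a b} hab => ?_⟩
  · obtain ⟨m, hm, hPm⟩ := Ideal.exists_le_maximal P hP.ne_top
    exact (hprime m hm).ne_top (top_le_iff.1 (htop ▸ Ideal.map_mono hPm))
  · let V : S → Set (Ideal R) :=
      fun x => {m | (P ≤ m ∧ m.IsMaximal) ∧ x ∈ Ideal.map (algebraMap R S) m}
    have hVab : {m : Ideal R | P ≤ m ∧ m.IsMaximal} ⊆ V a ∪ V b := fun m hm =>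
      ((hprime m hm.2).mem_or_mem (Ideal.map_mono hm.1 hab)).imp (⟨hm, ·⟩) (⟨hm, ·⟩)
    have hinf : sInf (V a) ⊓ sInf (V b) ≤ P := by
      rw [← sInf_union]
      refine (sInf_le_sInf hVab).trans (le_of_eq ?_)
      exact IsJacobsonRing.out inferInstance hP.isRadical
    exact (hP.inf_le.1 hinf).imp (mem_map _ a · fun m hm => hm.2) (mem_map _ b · fun m hm => hm.2)
end

section
/- Let R be an ℕ-graded commutative ring that is an integral domain, and let F_1,…,F_n be a regular sequence of homogeneous elements of R such that the ideal P = (F_1,…,F_n) is prime. Let f_1,…,f_n be elements of R whose leading forms (highest-degree homogeneous components) are F_1,…,F_n, respectively. Then the ideal Q = (f_1,…,f_n) of R is prime. -/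
universe u

namespace GradedRing

variable {R : Type*} [CommRing R] (𝒜 : ℕ → AddSubmonoid R) [GradedRing 𝒜]

/-- The additive subgroup of elements all of whose homogeneous components of degree at least `N`
vanish. -/
def degreeLT (N : ℕ) : AddSubgroup R where
  carrier := {x | ∀ j, N ≤ j → proj 𝒜 j x = 0}
  zero_mem' _ _ := map_zero _
  add_mem' hx hy j hj := by rw [map_add, hx j hj, hy j hj, add_zero]
  neg_mem' hx j hj := by rw [map_neg, hx j hj, neg_zero]

variable {𝒜}

theorem mem_degreeLT {N : ℕ} {x : R} :
    x ∈ degreeLT 𝒜 N ↔ ∀ j, N ≤ j → proj 𝒜 j x = 0 :=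
  Iff.rfl

theorem degreeLT_mono {M N : ℕ} (h : M ≤ N) : degreeLT 𝒜 M ≤ degreeLT 𝒜 N :=
  fun _ hx j hj => hx j (h.trans hj)

theorem eq_zero_of_mem_degreeLT_zero {x : R} (hx : x ∈ degreeLT 𝒜 0) : x = 0 := by
  classical
  rw [← DirectSum.sum_support_decompose 𝒜 x]
  exact Finset.sum_eq_zero fun i _ => hx i i.zero_le

variable (𝒜) in
theorem exists_mem_degreeLT (x : R) : ∃ N, x ∈ degreeLT 𝒜 N := by
  classical
  refine ⟨(DirectSum.decompose 𝒜 x).support.sup id + 1, fun j hj => ?_⟩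
  by_contra hne
  have hmem : j ∈ (DirectSum.decompose 𝒜 x).support := by
    rw [DFinsupp.mem_support_iff]
    intro h
    exact hne (by rw [proj_apply, h, ZeroMemClass.coe_zero])
  have := Finset.le_sup (f := id) hmem
  simp only [id] at this
  omega

theorem mem_degreeLT_of_proj_eq_zero {N : ℕ} {x : R} (hx : x ∈ degreeLT 𝒜 (N + 1))
    (h : proj 𝒜 N x = 0) : x ∈ degreeLT 𝒜 N := fun j hj => by
  rcases hj.eq_or_lt with rfl | hlt
  exacts [h, hx j hlt]

theorem proj_mul (a b : R) (k : ℕ) :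
    proj 𝒜 k (a * b) =
      ∑ ij ∈ Finset.HasAntidiagonal.antidiagonal k, proj 𝒜 ij.1 a * proj 𝒜 ij.2 b := by
  simp only [proj_apply, DirectSum.decompose_mul, DirectSum.coe_mul_apply_eq_sum_antidiagonal]

theorem proj_mul_of_mem_degreeLT {a b : R} {N D : ℕ} (ha : a ∈ degreeLT 𝒜 (N + 1))
    (hb : b ∈ degreeLT 𝒜 (D + 1)) : proj 𝒜 (N + D) (a * b) = proj 𝒜 N a * proj 𝒜 D b := by
  rw [proj_mul]
  refine Finset.sum_eq_single_of_mem (N, D) (by simp) fun ij hij hne => ?_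
  rw [Finset.HasAntidiagonal.mem_antidiagonal] at hij
  rcases lt_trichotomy ij.1 N with h | h | h
  · rw [hb ij.2 (by omega), mul_zero]
  · exact absurd (Prod.ext h (by simp only; omega)) hne
  · rw [ha ij.1 h, zero_mul]

theorem mul_mem_degreeLT {a b : R} {N D : ℕ} (ha : a ∈ degreeLT 𝒜 N)
    (hb : b ∈ degreeLT 𝒜 (D + 1)) : a * b ∈ degreeLT 𝒜 (N + D) := fun k hk => by
  rw [proj_mul]
  refine Finset.sum_eq_zero fun ij hij => ?_
  rw [Finset.HasAntidiagonal.mem_antidiagonal] at hij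
  rcases lt_or_ge ij.1 N with h | h
  · rw [hb ij.2 (by omega), mul_zero]
  · rw [ha ij.1 h, zero_mul]

theorem proj_proj (k : ℕ) (x : R) : proj 𝒜 k (proj 𝒜 k x) = proj 𝒜 k x :=
  DirectSum.decompose_of_mem_same 𝒜 (DirectSum.decompose 𝒜 x k).2

theorem proj_mem_degreeLT (k : ℕ) (x : R) : proj 𝒜 k x ∈ degreeLT 𝒜 (k + 1) := fun _ hj =>
  DirectSum.decompose_of_mem_ne 𝒜 (DirectSum.decompose 𝒜 x k).2 (by omega)

variable (𝒜) in
/-- The ideal `J` contains the leading forms of all elements of `I`, and every homogeneous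
component of an element of `J` is zero or the leading form of an element of `I`. -/
structure IsLeadingIdeal (I J : Ideal R) : Prop where
  proj_mem : ∀ m, ∀ g ∈ I, g ∈ degreeLT 𝒜 (m + 1) → proj 𝒜 m g ∈ J
  exists_lift : ∀ m, ∀ x ∈ J, ∃ y ∈ I, y ∈ degreeLT 𝒜 (m + 1) ∧ proj 𝒜 m y = proj 𝒜 m x

theorem isLeadingIdeal_bot : IsLeadingIdeal 𝒜 (⊥ : Ideal R) ⊥ where
  proj_mem m g hg _ := by
    rw [Ideal.mem_bot] at hg ⊢
    rw [hg, map_zero]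
  exists_lift m x hx := by
    rw [Ideal.mem_bot] at hx
    exact ⟨0, zero_mem _, zero_mem _, by rw [hx]⟩

namespace IsLeadingIdeal

variable {I J : Ideal R}

/-- An element of `I` can be subtracted from `g` to lower its degree if the top component of `g`
lies in `J`. -/
theorem exists_sub_mem_degreeLT (h : IsLeadingIdeal 𝒜 I J) {N : ℕ} {g : R}
    (hg : g ∈ degreeLT 𝒜 (N + 1)) (hgJ : proj 𝒜 N g ∈ J) :
    ∃ y ∈ I, g - y ∈ degreeLT 𝒜 N := by
  obtain ⟨y, hyI, hy, hyp⟩ := h.exists_lift N _ hgJ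
  refine ⟨y, hyI, mem_degreeLT_of_proj_eq_zero (sub_mem hg hy) ?_⟩
  rw [map_sub, hyp, proj_proj, sub_self]

theorem proj_add_mul_mem (h : IsLeadingIdeal 𝒜 I J) {f : R} {D : ℕ}
    (hf : f ∈ degreeLT 𝒜 (D + 1)) (hreg : ∀ x, x * proj 𝒜 D f ∈ J → x ∈ J) (m N : ℕ) :
    ∀ q ∈ I, ∀ a ∈ degreeLT 𝒜 N, q + a * f ∈ degreeLT 𝒜 (m + 1) →
      proj 𝒜 m (q + a * f) ∈ J ⊔ Ideal.span {proj 𝒜 D f} := by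
  induction N with
  | zero =>
    intro q hq a ha hg
    rw [eq_zero_of_mem_degreeLT_zero ha, zero_mul, add_zero] at hg ⊢
    exact Ideal.mem_sup_left (h.proj_mem m q hq hg)
  | succ N ih =>
    intro q hq a ha hg
    have haf : a * f ∈ degreeLT 𝒜 (N + D + 1) := by
      have := mul_mem_degreeLT ha hf
      rwa [Nat.add_right_comm] at this
    have hq_eq : q = q + a * f - a * f := by ring
    rcases lt_or_ge m (N + D) with hlt | hle
    · have hqdeg : q ∈ degreeLT 𝒜 (N + D + 1) := by
        rw [hq_eq]
        exact sub_mem (degreeLT_mono (by omega) hg) haf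
      have htop := hg (N + D) hlt
      rw [map_add, proj_mul_of_mem_degreeLT ha hf, add_eq_zero_iff_neg_eq] at htop
      obtain ⟨y, hyI, hy⟩ := h.exists_sub_mem_degreeLT ha
        (hreg _ (htop ▸ neg_mem (h.proj_mem _ q hq hqdeg)))
      have heq : q + y * f + (a - y) * f = q + a * f := by ring
      have := ih (q + y * f) (add_mem hq (I.mul_mem_right f hyI)) (a - y) hy
      rw [heq] at this
      exact this hg
    · have hqdeg : q ∈ degreeLT 𝒜 (m + 1) := by
        rw [hq_eq]
        exact sub_mem hg (degreeLT_mono (by omega) haf)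
      rw [map_add]
      refine add_mem (Ideal.mem_sup_left (h.proj_mem m q hq hqdeg)) ?_
      rcases hle.eq_or_lt with heq | hlt
      · rw [← heq, proj_mul_of_mem_degreeLT ha hf]
        exact Ideal.mem_sup_right (Ideal.mul_mem_left _ _ (Ideal.mem_span_singleton_self _))
      · rw [haf m hlt]
        exact zero_mem _

/-- Adjoining to `I` an element whose leading form is a nonzerodivisor modulo `J`. -/
theorem sup_span_singleton (h : IsLeadingIdeal 𝒜 I J) {f : R} {D : ℕ}
    (hf : f ∈ degreeLT 𝒜 (D + 1)) (hreg : ∀ x, x * proj 𝒜 D f ∈ J → x ∈ J) :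
    IsLeadingIdeal 𝒜 (I ⊔ Ideal.span {f}) (J ⊔ Ideal.span {proj 𝒜 D f}) where
  proj_mem m g hg hgm := by
    obtain ⟨q, hq, z, hz, rfl⟩ := Submodule.mem_sup.mp hg
    obtain ⟨a, rfl⟩ := Ideal.mem_span_singleton'.mp hz
    obtain ⟨N, hN⟩ := exists_mem_degreeLT 𝒜 a
    exact h.proj_add_mul_mem hf hreg m N q hq a hN hgm
  exists_lift m x hx := by
    obtain ⟨p, hp, z, hz, rfl⟩ := Submodule.mem_sup.mp hx
    obtain ⟨b, rfl⟩ := Ideal.mem_span_singleton'.mp hz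
    obtain ⟨y, hyI, hy, hyp⟩ := h.exists_lift m p hp
    have hmem : proj 𝒜 D f ∈ 𝒜 D := (DirectSum.decompose 𝒜 f D).2
    by_cases hle : D ≤ m
    · have hc := proj_mem_degreeLT (𝒜 := 𝒜) (m - D) b
      have hmD : m - D + D = m := Nat.sub_add_cancel hle
      refine ⟨y + proj 𝒜 (m - D) b * f, add_mem (Ideal.mem_sup_left hyI) (Ideal.mem_sup_right
        (Ideal.mul_mem_left _ _ (Ideal.mem_span_singleton_self f))),
        add_mem hy (degreeLT_mono (by omega) (mul_mem_degreeLT hc hf)), ?_⟩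
      have h₁ := proj_mul_of_mem_degreeLT hc hf
      rw [proj_proj, hmD] at h₁
      have h₂ : proj 𝒜 m (b * proj 𝒜 D f) = proj 𝒜 (m - D) b * proj 𝒜 D f :=
        DirectSum.coe_decompose_mul_of_right_mem_of_le 𝒜 hmem hle
      rw [map_add, map_add, hyp, h₁, h₂]
    · refine ⟨y, Ideal.mem_sup_left hyI, hy, ?_⟩
      have h₂ : proj 𝒜 m (b * proj 𝒜 D f) = 0 :=
        DirectSum.coe_decompose_mul_of_right_mem_of_not_le 𝒜 hmem hle
      rw [map_add, hyp, h₂, add_zero]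

theorem mem_or_mem (h : IsLeadingIdeal 𝒜 I J) (hJ : J.IsPrime) (k : ℕ) :
    ∀ M N : ℕ, M + N = k → ∀ a ∈ degreeLT 𝒜 M, ∀ b ∈ degreeLT 𝒜 N, a * b ∈ I →
      a ∈ I ∨ b ∈ I := by
  induction k with
  | zero =>
    intro M N hMN a ha b hb hab
    obtain rfl : M = 0 := by omega
    exact Or.inl (eq_zero_of_mem_degreeLT_zero ha ▸ zero_mem I)
  | succ k ih =>
    rintro (_ | M) (_ | N) hMN a ha b hb hab
    · exact Or.inl (eq_zero_of_mem_degreeLT_zero ha ▸ zero_mem I)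
    · exact Or.inl (eq_zero_of_mem_degreeLT_zero ha ▸ zero_mem I)
    · exact Or.inr (eq_zero_of_mem_degreeLT_zero hb ▸ zero_mem I)
    · have hab' : a * b ∈ degreeLT 𝒜 (M + N + 1) :=
        degreeLT_mono (by omega) (mul_mem_degreeLT ha hb)
      have hprod := h.proj_mem _ _ hab hab'
      rw [proj_mul_of_mem_degreeLT ha hb] at hprod
      rcases hJ.mem_or_mem hprod with hmem | hmem
      · obtain ⟨y, hyI, hy⟩ := h.exists_sub_mem_degreeLT ha hmem
        have hmul : (a - y) * b ∈ I := by
          rw [sub_mul]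
          exact sub_mem hab (I.mul_mem_right b hyI)
        refine (ih M (N + 1) (by omega) _ hy b hb hmul).imp_left fun hsub => ?_
        simpa using add_mem hsub hyI
      · obtain ⟨y, hyI, hy⟩ := h.exists_sub_mem_degreeLT hb hmem
        have hmul : a * (b - y) ∈ I := by
          rw [mul_sub]
          exact sub_mem hab (I.mul_mem_left a hyI)
        refine (ih (M + 1) N (by omega) a ha _ hy hmul).imp_right fun hsub => ?_
        simpa using add_mem hsub hyI

theorem isPrime (h : IsLeadingIdeal 𝒜 I J) (hJ : J.IsPrime) : I.IsPrime where
  ne_top' hI := by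
    have hone : (1 : R) ∈ 𝒜 0 := SetLike.GradedOne.one_mem
    have hproj : proj 𝒜 0 (1 : R) = 1 := DirectSum.decompose_of_mem_same 𝒜 hone
    have := h.proj_mem 0 1 (hI ▸ Submodule.mem_top) (hproj ▸ proj_mem_degreeLT 0 (1 : R))
    exact hJ.one_notMem (hproj ▸ this)
  mem_or_mem' {a b} hab := by
    obtain ⟨M, hM⟩ := exists_mem_degreeLT 𝒜 a
    obtain ⟨N, hN⟩ := exists_mem_degreeLT 𝒜 b
    exact h.mem_or_mem hJ _ M N rfl a hM b hN hab

end IsLeadingIdeal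

theorem isLeadingIdeal_ofList_take {n : ℕ} {F f : Fin n → R} {D : Fin n → ℕ}
    (hf : ∀ i, f i ∈ degreeLT 𝒜 (D i + 1)) (hF : ∀ i, proj 𝒜 (D i) (f i) = F i)
    (hreg : RingTheory.Sequence.IsWeaklyRegular R (List.ofFn F)) (k : ℕ) (hk : k ≤ n) :
    IsLeadingIdeal 𝒜 (Ideal.ofList ((List.ofFn f).take k))
      (Ideal.ofList ((List.ofFn F).take k)) := by
  induction k with
  | zero =>
    rw [List.take_zero, List.take_zero, Ideal.ofList_nil]
    exact isLeadingIdeal_bot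
  | succ k ih =>
    have hkF : k < (List.ofFn F).length := by simpa using hk
    have hkf : k < (List.ofFn f).length := by simpa using hk
    have hsmul := hreg.regular_mod_prev k hkF
    rw [List.take_succ_eq_append_getElem hkF, List.take_succ_eq_append_getElem hkf,
      Ideal.ofList_append, Ideal.ofList_append, Ideal.ofList_singleton, Ideal.ofList_singleton]
    rw [smul_eq_mul, Ideal.mul_top, isSMulRegular_quotient_iff_mem_of_smul_mem] at hsmul
    simp only [List.getElem_ofFn] at hsmul ⊢
    rw [← hF] at hsmul ⊢
    exact (ih (by omega)).sup_span_singleton (hf _) fun x hx => hsmul x (by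
      rwa [smul_eq_mul, mul_comm])

end GradedRing

/-- Let `R` be an `ℕ`-graded commutative ring which is a domain, and let
`F_1, …, F_n` be a regular sequence of homogeneous elements generating a prime ideal `P`.
If `f_1, …, f_n` are elements of `R` whose leading forms (nonzero homogeneous components of
highest degree) are `F_1, …, F_n`, then the ideal `Q = (f_1, …, f_n)` is prime. -/
theorem statement19 (R : Type u) [CommRing R] [IsDomain R]
    (𝒜 : ℕ → AddSubmonoid R) [GradedRing 𝒜]
    (n : ℕ) (F f : Fin n → R) (D : Fin n → ℕ)
    (hlead : ∀ i, ((DirectSum.decompose 𝒜 (f i) (D i) : 𝒜 (D i)) : R) = F i)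
    (hFne : ∀ i, F i ≠ 0)
    (htop : ∀ i, ∀ j : ℕ, D i < j → ((DirectSum.decompose 𝒜 (f i) j : 𝒜 j) : R) = 0)
    (hreg : RingTheory.Sequence.IsRegular R (List.ofFn F))
    (hprime : (Ideal.span (Set.range F)).IsPrime) :
    (Ideal.span (Set.range f)).IsPrime := by
  have h := GradedRing.isLeadingIdeal_ofList_take (𝒜 := 𝒜) (fun i j hj => htop i j hj) hlead
    hreg.toIsWeaklyRegular n le_rfl
  rw [List.take_of_length_le (by simp), List.take_of_length_le (by simp)] at h
  have hspan (g : Fin n → R) : Ideal.ofList (List.ofFn g) = Ideal.span (Set.range g) :=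
    congrArg Ideal.span (Set.ext fun x => by simp)
  rw [hspan, hspan] at h
  exact h.isPrime hprime
end
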